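/- Let G be a finite group and W a finite-dimensional complex representation of G. Then there exist two distinct polynomials f and g with nonnegative integer coefficients such that the G-modules f(W) and g(W) are isomorphic, where for f(x) = Σ aᵢxⁱ one sets f(W) = ⊕ᵢ (W^{⊗i})^{⊕aᵢ} and W^{⊗0} is the trivial one-dimensional representation. -/

import Mathlib

/-!
For a finite group `G`, a finite-dimensional complex representation of `G` is an object
of the category `FDRep ℂ G`, and isomorphism of `G`-modules is isomorphism in this
category.  We construct `f(W) = ⊕ᵢ (W^{⊗i})^{⊕aᵢ}` for a polynomial
`f(x) = Σᵢ aᵢ xⁱ` with nonnegative integer coefficients, using the monoidal structure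
(tensor product of representations) and biproducts (direct sums of representations),
with `W^{⊗0}` the trivial one-dimensional representation (the monoidal unit).
-/

open CategoryTheory CategoryTheory.Limits CategoryTheory.MonoidalCategory ZeroObject

noncomputable instance (G : Type) [Group G] : HasBinaryBiproducts (FDRep ℂ G) :=
  HasBinaryBiproducts.of_hasBinaryProducts

instance (G : Type) [Group G] : HasZeroObject (FDRep ℂ G) :=
  hasZeroObject_of_hasTerminal_object

variable {G : Type} [Group G]

/-- The `n`-th tensor power `W^{⊗n}` of a representation, with `W^{⊗0}` the trivial
one-dimensional representation. -/
noncomputable def tpowRep (W : FDRep ℂ G) : ℕ → FDRep ℂ G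
  | 0 => 𝟙_ (FDRep ℂ G)
  | n + 1 => tpowRep W n ⊗ W

/-- The direct sum `W^{⊕n}` of `n` copies of a representation. -/
noncomputable def copiesRep : ℕ → FDRep ℂ G → FDRep ℂ G
  | 0, _ => 0
  | n + 1, W => W ⊞ copiesRep n W

/-- For a polynomial `f(x) = Σᵢ aᵢ xⁱ` with nonnegative integer coefficients,
`polyRep f W = f(W) = ⊕ᵢ (W^{⊗i})^{⊕aᵢ}`. -/
noncomputable def polyRep (f : Polynomial ℕ) (W : FDRep ℂ G) : FDRep ℂ G :=
  (List.range (f.natDegree + 1)).foldr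
    (fun i acc => copiesRep (f.coeff i) (tpowRep W i) ⊞ acc) 0

/-- A semisimple ring has only finitely many simple modules up to isomorphism, and each of them
is isomorphic to an ideal. -/
theorem IsSemisimpleRing.exists_finite_ideals_linearEquiv (R : Type*) [Ring R]
    [IsSemisimpleRing R] :
    ∃ s : Set (Ideal R), s.Finite ∧
      ∀ (M : Type*) [AddCommGroup M] [Module R M] [IsSimpleModule R M],
        ∃ I : s, Nonempty (M ≃ₗ[R] I) := by
  obtain ⟨s, ind, hs, simple⟩ := IsSemisimpleModule.exists_sSupIndep_sSup_simples_eq_top R R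
  refine ⟨s, WellFoundedGT.finite_of_sSupIndep ind, fun M _ _ _ ↦ ?_⟩
  obtain ⟨I, ⟨e⟩⟩ := IsSemisimpleRing.exists_linearEquiv_ideal_of_isSimpleModule R M
  have : IsSimpleModule R I := .congr e.symm
  have : ∀ J : s, IsSimpleModule R J := SetCoe.forall.mpr simple
  obtain ⟨J, hJ, ⟨e'⟩⟩ := Submodule.linearEquiv_of_sSup_eq_top I s hs
  exact ⟨⟨J, hJ⟩, ⟨e.trans e'⟩⟩

section Multiplicities

variable {R ι : Type*} [Ring R] (T : ι → Type*) [∀ i, AddCommGroup (T i)] [∀ i, Module R (T i)]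

variable (R) in
/-- The module `M` is isomorphic to the product of the modules `T i`, each taken `m i` times. -/
def HasMultiplicities (M : Type*) [AddCommGroup M] [Module R M] (m : ι → ℕ) : Prop :=
  Nonempty (M ≃ₗ[R] ∀ i, Fin (m i) → T i)

variable {T} {M N : Type*} [AddCommGroup M] [Module R M] [AddCommGroup N] [Module R N]

theorem HasMultiplicities.of_subsingleton [Subsingleton M] : HasMultiplicities R T M 0 :=
  have (i : ι) : IsEmpty (Fin ((0 : ι → ℕ) i)) := inferInstanceAs (IsEmpty (Fin 0))
  ⟨0⟩

theorem HasMultiplicities.congr {m : ι → ℕ} (h : HasMultiplicities R T N m) (e : M ≃ₗ[R] N) :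
    HasMultiplicities R T M m :=
  h.map e.trans

theorem HasMultiplicities.prod {m n : ι → ℕ} (hM : HasMultiplicities R T M m)
    (hN : HasMultiplicities R T N n) : HasMultiplicities R T (M × N) (m + n) := by
  obtain ⟨e⟩ := hM
  obtain ⟨e'⟩ := hN
  let split (i : ι) : (Fin ((m + n) i) → T i) ≃ₗ[R] (Fin (m i) → T i) × (Fin (n i) → T i) :=
    (LinearEquiv.funCongrLeft R (T i) finSumFinEquiv).trans
      (LinearEquiv.sumArrowLequivProdArrow _ _ R (T i))
  let swap : (∀ i, (Fin (m i) → T i) × (Fin (n i) → T i)) ≃ₗ[R]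
      (∀ i, Fin (m i) → T i) × (∀ i, Fin (n i) → T i) :=
    { toFun v := (fun i ↦ (v i).1, fun i ↦ (v i).2)
      invFun v i := (v.1 i, v.2 i)
      map_add' _ _ := rfl
      map_smul' _ _ := rfl }
  exact ⟨(e.prodCongr e').trans ((LinearEquiv.piCongrRight split).trans swap).symm⟩

theorem exists_hasMultiplicities [IsSemisimpleModule R M] [Module.Finite R M]
    (hT : ∀ S : Submodule R M, IsSimpleModule R S → ∃ i, Nonempty (S ≃ₗ[R] T i)) :
    ∃ m : ι → ℕ, HasMultiplicities R T M m := by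
  obtain ⟨n, S, e, simple⟩ := IsSemisimpleModule.exists_linearEquiv_fin_dfinsupp R M
  choose c hc using fun i ↦ hT (S i) (simple i)
  have hfib (p : Σ j, {i // c i = j}) : Nonempty (S p.2 ≃ₗ[R] T p.1) := by
    obtain ⟨_, i, rfl⟩ := p
    exact hc i
  let efib := fun p ↦ (hfib p).some
  exact ⟨fun j ↦ Nat.card {i // c i = j},
    ⟨e.trans <| (DFinsupp.linearEquivFunOnFintype (R := R)).trans <|
      (LinearEquiv.piCongrLeft R (fun i ↦ S i) (Equiv.sigmaFiberEquiv c)).symm.trans <|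
      (LinearEquiv.piCongrRight efib).trans <|
      (LinearEquiv.piCurry R fun j (_ : {i // c i = j}) ↦ T j).trans <|
      LinearEquiv.piCongrRight fun j ↦
        LinearEquiv.funCongrLeft R (T j) (Finite.equivFin {i // c i = j}).symm⟩⟩

end Multiplicities

instance : (forget₂ (FDRep ℂ G) (Rep ℂ G)).Additive where

instance : (Rep.toModuleMonoidAlgebra (k := ℂ) (G := G)).Additive where

variable (G) in
/-- The functor regarding a finite-dimensional representation as a module over the group
algebra. -/
noncomputable abbrev FDRep.toModuleMonoidAlgebra : FDRep ℂ G ⥤ ModuleCat (MonoidAlgebra ℂ G) :=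
  forget₂ (FDRep ℂ G) (Rep ℂ G) ⋙ Rep.toModuleMonoidAlgebra

instance (V : FDRep ℂ G) :
    Module.Finite (MonoidAlgebra ℂ G) ((FDRep.toModuleMonoidAlgebra G).obj V) :=
  have : Module.Finite ℂ (Representation.asModule V.ρ) := inferInstance
  have : Module.Finite (MonoidAlgebra ℂ G) (Representation.asModule V.ρ) :=
    .of_restrictScalars_finite ℂ _ _
  this

section Additivity

variable {ι : Type} {T : ι → Type} [∀ i, AddCommGroup (T i)]
  [∀ i, Module (MonoidAlgebra ℂ G) (T i)]

variable (T) in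
/-- The representation `V` is isomorphic to the direct sum of the modules `T i` over the group
algebra, each taken `m i` times. -/
def FDRep.HasMultiplicities (V : FDRep ℂ G) (m : ι → ℕ) : Prop :=
  _root_.HasMultiplicities (MonoidAlgebra ℂ G) T ((FDRep.toModuleMonoidAlgebra G).obj V) m

namespace FDRep.HasMultiplicities

theorem nonempty_iso {V W : FDRep ℂ G} {m : ι → ℕ} (hV : V.HasMultiplicities T m)
    (hW : W.HasMultiplicities T m) : Nonempty (V ≅ W) := by
  obtain ⟨e⟩ := hV
  obtain ⟨e'⟩ := hW
  exact ⟨(FDRep.toModuleMonoidAlgebra G).preimageIso (e.trans e'.symm).toModuleIso⟩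

theorem zero : (0 : FDRep ℂ G).HasMultiplicities T 0 :=
  have := ModuleCat.subsingleton_of_isZero
    ((FDRep.toModuleMonoidAlgebra G).map_isZero (isZero_zero (FDRep ℂ G)))
  .of_subsingleton

theorem biprod {V W : FDRep ℂ G} {m n : ι → ℕ} (hV : V.HasMultiplicities T m)
    (hW : W.HasMultiplicities T n) : (V ⊞ W).HasMultiplicities T (m + n) :=
  have := preservesBinaryBiproducts_of_preservesBiproducts (FDRep.toModuleMonoidAlgebra G)
  (hV.prod hW).congr
    ((FDRep.toModuleMonoidAlgebra G).mapBiprod V W ≪≫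
      ModuleCat.biprodIsoProd _ _).toLinearEquiv

theorem copiesRep {V : FDRep ℂ G} {m : ι → ℕ} (hV : V.HasMultiplicities T m) (n : ℕ) :
    (copiesRep n V).HasMultiplicities T (n • m) := by
  induction n with
  | zero => simpa only [zero_smul, _root_.copiesRep] using zero
  | succ n ih => simpa only [succ_nsmul', _root_.copiesRep] using hV.biprod ih

theorem polyRep {W : FDRep ℂ G} {m : ℕ → ι → ℕ}
    (h : ∀ i, (tpowRep W i).HasMultiplicities T (m i)) (f : Polynomial ℕ) :
    (polyRep f W).HasMultiplicities T (f.sum fun i a ↦ a • m i) := by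
  have hfold (l : List ℕ) :
      (l.foldr (fun i acc ↦ _root_.copiesRep (f.coeff i) (tpowRep W i) ⊞ acc) 0).HasMultiplicities
        T (l.map fun i ↦ f.coeff i • m i).sum := by
    induction l with
    | nil => exact zero
    | cons i l ih => exact ((h i).copiesRep _).biprod ih
  rw [Polynomial.sum_over_range _ (by simp)]
  exact hfold _

end FDRep.HasMultiplicities

end Additivity

/-- Any sequence of vectors in a finite free `ℕ`-module satisfies a nontrivial polynomial
relation. -/
theorem Polynomial.exists_ne_sum_smul_eq {ι : Type*} [Finite ι] (m : ℕ → ι → ℕ) :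
    ∃ f g : Polynomial ℕ, f ≠ g ∧ (f.sum fun i a ↦ a • m i) = g.sum fun i a ↦ a • m i := by
  by_contra! h
  have hm : LinearIndependent ℕ m := fun a b hab ↦ by
    apply (Polynomial.basisMonomials ℕ).repr.symm.injective
    by_contra hne
    exact h _ _ hne hab
  exact (Cardinal.mk_nat ▸ hm.lt_aleph0_of_finite).false

/-- **Lemma.** Let `G` be a finite group and `W` a finite-dimensional complex
representation of `G`.  Then there exist two distinct polynomials `f` and `g` with
nonnegative integer coefficients such that the `G`-modules `f(W)` and `g(W)` are
isomorphic. -/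
theorem exists_distinct_poly_iso_of_finite_group
    (G : Type) [Group G] [Finite G] (W : FDRep ℂ G) :
    ∃ f g : Polynomial ℕ, f ≠ g ∧ Nonempty (polyRep f W ≅ polyRep g W) := by
  obtain ⟨s, hs, hsimple⟩ :=
    IsSemisimpleRing.exists_finite_ideals_linearEquiv (MonoidAlgebra ℂ G)
  have := hs.to_subtype
  have hmult (V : FDRep ℂ G) :
      ∃ m, V.HasMultiplicities (fun I : s ↦ I) m :=
    exists_hasMultiplicities fun S _ ↦ hsimple S
  choose m hm using fun i ↦ hmult (tpowRep W i)
  obtain ⟨f, g, hne, hfg⟩ := Polynomial.exists_ne_sum_smul_eq m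
  have hg := FDRep.HasMultiplicities.polyRep hm g
  rw [← hfg] at hg
  exact ⟨f, g, hne, (FDRep.HasMultiplicities.polyRep hm f).nonempty_iso hg⟩
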